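/- Let a, q ∈ ℂ with a ≠ 0 and q ≠ 0, let ℓ be an integer with q^ℓ ≠ 1, and let k ≥ 0 be an integer such that (qa;q)_{k+1} ≠ 0, 1 - q^k a ≠ 0, q^ℓ - q^k a ≠ 0 and q^ℓ - q^{k+1} a ≠ 0. Then (1-q^ℓ a)·h_k(a,q;ℓ+1) - (a-q^ℓ)·h_k(a,q;ℓ) = h̃_{k+1}(a,q;ℓ) - h̃_k(a,q;ℓ), where h̃_k(a,q;ℓ) = [(1-q^k a)³ (1+q^ℓ)(a-q^ℓ) q^{ℓ-k} / (a (1-q^ℓ)² (q^ℓ - q^k a))] · h_k(a,q;ℓ). -/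

import Mathlib

open Finset

/-- The q-Pochhammer symbol `(x;q)_k = ∏_{j=0}^{k-1} (1 - x q^j)`. -/
noncomputable def qPoch (x q : ℂ) (k : ℕ) : ℂ := ∏ j ∈ Finset.range k, (1 - x * q ^ j)

/-- The summand `h_k(a,q;ℓ)`. -/
noncomputable def h (a q : ℂ) (l : ℤ) (k : ℕ) : ℂ :=
  (1 - a) * qPoch (q ^ l * a) q k * qPoch (q ^ (1 - l) * a) q k * q ^ k /
    ((1 - q ^ k * a) * (qPoch (q * a) q k) ^ 2)

/-- The certificate `h̃_k(a,q;ℓ)`. -/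
noncomputable def htilde (a q : ℂ) (l : ℤ) (k : ℕ) : ℂ :=
  (1 - q ^ k * a) ^ 3 * (1 + q ^ l) * (a - q ^ l) * q ^ (l - (k : ℤ)) /
    (a * (1 - q ^ l) ^ 2 * (q ^ l - q ^ k * a)) * h a q l k

lemma qPoch_succ (x q : ℂ) (k : ℕ) :
    qPoch x q (k + 1) = qPoch x q k * (1 - x * q ^ k) :=
  Finset.prod_range_succ _ _

lemma one_sub_mul_qPoch_mul (x q : ℂ) (k : ℕ) :
    (1 - x) * qPoch (q * x) q k = qPoch x q k * (1 - x * q ^ k) := by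
  rw [← qPoch_succ, qPoch, qPoch, Finset.prod_range_succ', pow_zero, mul_one, mul_comm]
  congr 1
  exact Finset.prod_congr rfl fun j _ ↦ by ring

theorem stmt_6 (a q : ℂ) (ha : a ≠ 0) (hq : q ≠ 0) (l : ℤ) (hl : q ^ l ≠ 1)
    (k : ℕ) (hk : qPoch (q * a) q (k + 1) ≠ 0) (hk1 : 1 - q ^ k * a ≠ 0)
    (hk2 : q ^ l - q ^ k * a ≠ 0) (hk3 : q ^ l - q ^ (k + 1) * a ≠ 0) :
    (1 - q ^ l * a) * h a q (l + 1) k - (a - q ^ l) * h a q l k =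
      htilde a q l (k + 1) - htilde a q l k := by
  have hL : q ^ l ≠ 0 := zpow_ne_zero l hq
  have hQ : q ^ k ≠ 0 := pow_ne_zero k hq
  have e1 : q ^ (l + 1) = q * q ^ l := by rw [zpow_add_one₀ hq, mul_comm]
  have e2 : q ^ (1 - (l + 1)) = (q ^ l)⁻¹ := by rw [← zpow_neg]; congr 1; ring
  have e3 : q ^ (1 - l) = q * (q ^ l)⁻¹ := by rw [zpow_sub₀ hq, zpow_one, div_eq_mul_inv]
  have e4 : q ^ (l - (k : ℤ)) = q ^ l / q ^ k := by rw [zpow_sub₀ hq, zpow_natCast]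
  have e5 : q ^ (l - ((k + 1 : ℕ) : ℤ)) = q ^ l / (q ^ k * q) := by
    rw [zpow_sub₀ hq, zpow_natCast, pow_succ]
  have hA := one_sub_mul_qPoch_mul (q ^ l * a) q k
  have hB := one_sub_mul_qPoch_mul ((q ^ l)⁻¹ * a) q k
  rw [qPoch_succ] at hk
  obtain ⟨hP, hR⟩ := mul_ne_zero_iff.mp hk
  simp only [htilde, h, e1, e2, e3, e4, e5, qPoch_succ, mul_assoc q] at *
  simp only [pow_succ q k] at *
  generalize q ^ l = L at *
  generalize q ^ k = Q at *
  generalize qPoch (q * (L * a)) q k = A' at *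
  generalize qPoch (L * a) q k = A at *
  generalize qPoch (q * (L⁻¹ * a)) q k = B at *
  generalize qPoch (L⁻¹ * a) q k = B' at *
  generalize qPoch (q * a) q k = P at *
  have h1L : 1 - L ≠ 0 := sub_ne_zero.mpr hl.symm
  have hR' : 1 - Q * q * a ≠ 0 := by convert hR using 1; ring
  have hB' : B' = (L - a) * B / (L - Q * a) := by
    rw [eq_div_iff hk2]
    field_simp at hB
    linear_combination -hB
  have lhs : (1 - L * a) * ((1 - a) * A' * B' * Q / ((1 - Q * a) * P ^ 2)) =
      (1 - a) * (A * (1 - L * a * Q)) * B' * Q / ((1 - Q * a) * P ^ 2) := by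
    rw [← hA]; ring
  have e6 : 1 - q * (a * Q) = 1 - Q * q * a := by ring
  have e7 : 1 - q * (L⁻¹ * a * Q) = (L - Q * q * a) / L := by field_simp
  rw [lhs, hB', e6, e7]
  have d1 : 1 - a * Q ≠ 0 := by rwa [mul_comm]
  have d2 : L - a * Q ≠ 0 := by rwa [mul_comm a]
  have d3 : 1 - a * Q * q ≠ 0 := by rwa [mul_assoc, mul_comm]
  have d4 : L - a * Q * q ≠ 0 := by rwa [mul_assoc, mul_comm a]
  field_simp
  ring
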